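/- Let q range over all primes. Assume that for every prime q and every finite solvable group G of characteristic q (i.e. C_G(O_q(G)) ≤ O_q(G)), whenever H and K are subgroups of G with H maximal in G and K isomorphic to H (as abstract groups), then K is also maximal in G. Then for every finite solvable group G, whenever H and K are subgroups of G with H maximal in G and K isomorphic to H, K is maximal in G. (Theorem A) -/

import Mathlib

/-- `O_p(G)`: the `p`-core of `G`, i.e. the largest normal `p`-subgroup of `G`
(for finite `G` the join of all normal `p`-subgroups is the largest one). -/
def pCore (p : ℕ) (G : Type*) [Group G] : Subgroup G :=
  sSup {N : Subgroup G | N.Normal ∧ IsPGroup p N}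

open Subgroup

section PCore

variable {G : Type*} [Group G]

theorem le_pCore {p : ℕ} {N : Subgroup G} (hN : N.Normal) (hp : IsPGroup p N) : N ≤ pCore p G :=
  le_sSup ⟨hN, hp⟩

instance pCore_characteristic (p : ℕ) : (pCore p G).Characteristic := by
  rw [characteristic_iff_map_le]
  intro φ
  rw [pCore, (gc_map_comap φ.toMonoidHom).l_sSup]
  refine iSup₂_le fun N hN ↦ le_pCore ?_ (hN.2.map _)
  exact hN.1.map _ φ.surjective

theorem isPGroup_pCore (p : ℕ) [Fact p.Prime] [Finite G] : IsPGroup p (pCore p G) :=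
  Sylow.sSup_of_normal _ (fun _ h ↦ h.2) (fun _ h ↦ h.1)

/-- A normal `p`-subgroup of a normal subgroup lies in the `p`-core of the whole group. -/
theorem le_pCore_of_le_normal {p : ℕ} [Fact p.Prime] [Finite G] {Y M : Subgroup G}
    [hM : M.Normal] (hY : IsPGroup p Y) (hYM : Y ≤ M)
    (hnorm : ∀ m ∈ M, ∀ y ∈ Y, m * y * m⁻¹ ∈ Y) : Y ≤ pCore p G := by
  have h1 : Y.subgroupOf M ≤ pCore p M := by
    refine le_pCore ⟨fun y hy m ↦ ?_⟩ (hY.comap_subtype)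
    exact hnorm m m.2 y hy
  have h2 : (pCore p M).map M.subtype ≤ pCore p G :=
    le_pCore inferInstance ((isPGroup_pCore p).map _)
  refine le_trans (fun y hy ↦ ?_) h2
  exact ⟨⟨y, hYM hy⟩, h1 (by simpa [mem_subgroupOf] using hy), rfl⟩

theorem normal_of_conj_mem_of_sup_eq_top {U V B : Subgroup G} (h : U ⊔ V = ⊤)
    (hU : ∀ u ∈ U, ∀ x ∈ B, u * x * u⁻¹ ∈ B) (hV : ∀ v ∈ V, ∀ x ∈ B, v * x * v⁻¹ ∈ B) :
    B.Normal := by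
  have key : ∀ W : Subgroup G, (∀ u ∈ W, ∀ x ∈ B, u * x * u⁻¹ ∈ B) →
      W ≤ normalizer (B : Set G) := by
    intro W hW
    rw [le_normalizer_iff_commutator_le_right, commutator_le]
    intro u hu x hx
    exact B.mul_mem (hW u hu x hx) (B.inv_mem hx)
  rw [← normalizer_eq_top_iff, eq_top_iff, ← h]
  exact sup_le (key U hU) (key V hV)

theorem IsCoatom.sup_eq_top_of_not_le {H N : Subgroup G} (hH : IsCoatom H) (hN : ¬ N ≤ H) :
    H ⊔ N = ⊤ :=
  hH.2 _ (left_lt_sup.2 hN)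

theorem card_mul_relIndex {H K : Subgroup G} (h : H ≤ K) :
    Nat.card H * H.relIndex K = Nat.card K := by
  simpa using relIndex_mul_relIndex ⊥ H K bot_le h

theorem relIndex_sup_of_normal [Finite G] (H N : Subgroup G) [N.Normal] :
    H.relIndex (H ⊔ N) = H.relIndex N := by
  have h1 := relIndex_sup_right (H := H) (K := N)
  have h2 := card_mul_relIndex (le_sup_left : H ≤ H ⊔ N)
  have h3 := card_mul_relIndex (le_sup_right : N ≤ H ⊔ N)
  have h4 := card_mul_relIndex (inf_le_left : H ⊓ N ≤ H)
  have h5 := card_mul_relIndex (inf_le_right : H ⊓ N ≤ N)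
  rw [inf_relIndex_left] at h4
  rw [inf_relIndex_right] at h5
  rw [h1] at h3
  have hp : 0 < Nat.card H := Nat.card_pos
  apply Nat.eq_of_mul_eq_mul_left hp
  rw [h2, ← h3, ← h4, ← h5]
  ring

theorem relIndex_dvd_index_of_normal_right [Finite G] (H N : Subgroup G) [N.Normal] :
    H.relIndex N ∣ H.index := by
  rw [← relIndex_sup_of_normal]
  exact relIndex_dvd_index_of_le le_sup_left

theorem IsPGroup.le_of_not_dvd_index [Finite G] {p : ℕ} [hp : Fact p.Prime] {N K : Subgroup G}
    [N.Normal] (hN : IsPGroup p N) (hK : ¬ p ∣ K.index) : N ≤ K := by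
  rw [← relIndex_eq_one]
  obtain ⟨k, hk⟩ := IsPGroup.iff_card.1 hN
  obtain ⟨m, -, hm⟩ := (Nat.dvd_prime_pow hp.1).1 (hk ▸ relIndex_dvd_card K N)
  rcases m with _ | m
  · simpa using hm
  · refine absurd (dvd_trans ?_ (relIndex_dvd_index_of_normal_right K N)) hK
    rw [hm, pow_succ]
    exact dvd_mul_left _ _

/-- A nilpotent normal subgroup lies in every subgroup containing all the cores `O_p(G)`. -/
theorem le_of_isNilpotent_of_pCore_le [Finite G] {F W : Subgroup G} [hW : W.Normal]
    [Group.IsNilpotent W] (hF : ∀ p : ℕ, p.Prime → pCore p G ≤ F) : W ≤ F := by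
  rw [← relIndex_eq_one]
  by_contra hne
  obtain ⟨p, hp, hdvd⟩ := Nat.exists_prime_and_dvd hne
  have : Fact p.Prime := ⟨hp⟩
  let P : Sylow p W := default
  have : (P : Subgroup W).Characteristic := P.characteristic_of_normal inferInstance
  have h1 : (P : Subgroup W).map W.subtype ≤ F :=
    (le_pCore inferInstance (P.isPGroup'.map _)).trans (hF p hp)
  have h2 : (P : Subgroup W) ≤ F.subgroupOf W := map_le_iff_le_comap.1 h1
  exact P.not_dvd_index (hdvd.trans (index_dvd_of_le h2))

/-- `C_G(F(G)) ≤ F(G)` for solvable `G`: a normal subgroup centralizing all the cores `O_p(G)` lies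
in every subgroup containing all of them. -/
theorem le_of_le_centralizer_pCore [Finite G] [Group.IsSolvable G] {F Y : Subgroup G} [Y.Normal]
    (hF : ∀ p : ℕ, p.Prime → pCore p G ≤ F)
    (hY : ∀ p : ℕ, p.Prime → Y ≤ centralizer (pCore p G : Set G)) : Y ≤ F := by
  set F₀ : Subgroup G := ⨆ (p : ℕ) (_ : p.Prime), pCore p G with hF₀
  have hcore : ∀ p : ℕ, p.Prime → pCore p G ≤ F₀ := fun p hp ↦ le_iSup₂_of_le p hp le_rfl
  refine le_trans ?_ (iSup₂_le hF : F₀ ≤ F)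
  have hYF : Y ≤ centralizer (F₀ : Set G) := by
    rw [le_centralizer_iff]
    exact iSup₂_le fun p hp ↦ le_centralizer_iff.1 (hY p hp)
  let D : ℕ → Subgroup G := fun n ↦ (derivedSeries Y n).map Y.subtype
  have hDn : ∀ n, (D n).Normal := fun n ↦ inferInstance
  have hD : ∀ n, D (n + 1) = ⁅D n, D n⁆ := fun n ↦ by
    simp only [D, derivedSeries_succ, map_commutator]
  have hDY : ∀ n, D n ≤ Y := fun n ↦ map_subtype_le _
  have hex : ∃ n, D n ≤ F₀ := by
    obtain ⟨n, hn⟩ := (inferInstance : Group.IsSolvable Y).solvable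
    exact ⟨n, by simp [D, hn]⟩
  classical
  obtain ⟨n, hn, hmin⟩ : ∃ n, D n ≤ F₀ ∧ ∀ m < n, ¬ D m ≤ F₀ :=
    ⟨Nat.find hex, Nat.find_spec hex, fun m hm ↦ Nat.find_min hex hm⟩
  rcases n with _ | n
  · rwa [show D 0 = Y by simp [D, ← MonoidHom.range_eq_map]] at hn
  · refine absurd ?_ (hmin n n.lt_succ_self)
    have : Group.IsNilpotent (D n) := by
      refine isNilpotent_of_lowerCentralSeries_eq_bot (n := 2) ?_
      change ⁅⁅D n, D n⁆, D n⁆ = ⊥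
      rw [← hD, commutator_eq_bot_iff_le_centralizer, le_centralizer_iff]
      exact (hDY n).trans (hYF.trans (centralizer_le hn))
    exact le_of_isNilpotent_of_pCore_le hcore

theorem index_eq_pow_of_not_pCore_le [Finite G] {H : Subgroup G} (hH : IsCoatom H) {p : ℕ}
    [hp : Fact p.Prime] (h : ¬ pCore p G ≤ H) : ∃ k, H.index = p ^ k := by
  have h1 := relIndex_sup_of_normal H (pCore p G)
  rw [hH.sup_eq_top_of_not_le h, relIndex_top_right] at h1
  obtain ⟨k, hk⟩ := IsPGroup.iff_card.1 (isPGroup_pCore (G := G) p)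
  obtain ⟨m, -, hm⟩ := (Nat.dvd_prime_pow hp.1).1 (hk ▸ relIndex_dvd_card H (pCore p G))
  exact ⟨m, h1.trans hm⟩

theorem IsCoatom.map_of_surjective {G' : Type*} [Group G'] {f : G →* G'}
    (hf : Function.Surjective f) {H : Subgroup G} (hker : f.ker ≤ H) (hH : IsCoatom H) :
    IsCoatom (H.map f) := by
  have hc : (H.map f).comap f = H := comap_map_eq_self hker
  refine ⟨fun h ↦ hH.1 (by rw [← hc, h, comap_top]), fun L hL ↦ ?_⟩
  have : H < L.comap f := by
    rw [← hc]
    exact (comap_lt_comap_of_surjective hf).2 hL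
  have h2 := hH.2 _ this
  rw [← map_comap_eq_self_of_surjective hf L, h2, map_top_of_surjective f hf]

/-- A maximal subgroup of a finite solvable group has prime power index. -/
theorem IsCoatom.exists_index_eq_prime_pow [Finite G] [Group.IsSolvable G] {H : Subgroup G}
    (hH : IsCoatom H) : ∃ p k : ℕ, p.Prime ∧ H.index = p ^ k := by
  have hex : ∃ n, derivedSeries G n ≤ H := by
    obtain ⟨n, hn⟩ := (inferInstance : Group.IsSolvable G).solvable
    exact ⟨n, by simp [hn]⟩
  classical
  obtain ⟨n, hn, hmin⟩ : ∃ n, derivedSeries G n ≤ H ∧ ∀ m < n, ¬ derivedSeries G m ≤ H :=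
    ⟨Nat.find hex, Nat.find_spec hex, fun m hm ↦ Nat.find_min hex hm⟩
  rcases n with _ | n
  · exact absurd (top_le_iff.1 hn) hH.1
  · let f := QuotientGroup.mk' H.normalCore
    have hf : Function.Surjective f := QuotientGroup.mk'_surjective _
    have hker : f.ker ≤ H := by
      simpa [f] using H.normalCore_le
    have hH' : IsCoatom (H.map f) := hH.map_of_surjective hf hker
    let A := (derivedSeries G n).map f
    have hA : A.Normal := Normal.map inferInstance f hf
    have hAA : ⁅A, A⁆ = ⊥ := by
      rw [← map_commutator, ← derivedSeries_succ, Subgroup.map_eq_bot_iff, QuotientGroup.ker_mk']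
      exact normal_le_normalCore.2 hn
    have : Group.IsNilpotent A := isNilpotent_of_lowerCentralSeries_eq_bot (n := 1) hAA
    have hnot : ¬ A ≤ H.map f := by
      rw [map_le_iff_le_comap, comap_map_eq_self hker]
      exact hmin n n.lt_succ_self
    by_contra! hcon
    refine hnot (le_of_isNilpotent_of_pCore_le fun p hp ↦ ?_)
    by_contra hp'
    have : Fact p.Prime := ⟨hp⟩
    obtain ⟨k, hk⟩ := index_eq_pow_of_not_pCore_le hH' hp'
    exact hcon p k hp (by rw [← hk, index_map_eq _ hf hker])

end PCore

section ChiefSeries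

variable {G : Type*} [Group G]

/-- A normal `p`-subgroup acts trivially on each chief factor below it. -/
theorem commutator_le_of_covBy_normal [Finite G] {p : ℕ} [Fact p.Prime] {P M N : Subgroup G}
    [hP : P.Normal] (hp : IsPGroup p P) [hM : M.Normal] [hN : N.Normal] (hMP : M ≤ P) (hNM : N < M)
    (hcov : ∀ T : Subgroup G, T.Normal → N ≤ T → T ≤ M → T = N ∨ T = M) : ⁅M, P⁆ ≤ N := by
  rcases hcov (⁅M, P⁆ ⊔ N) inferInstance le_sup_right (sup_le (commutator_le_left M P) hNM.le)
    with h | h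
  · exact le_sup_left.trans h.le
  exfalso
  have hnorm : ∀ k, (P.lowerCentralSeries k).Normal := by
    intro k
    induction k with
    | zero => exact hP
    | succ k ih => exact commutator_normal _ _
  have hle : ∀ k, M ≤ P.lowerCentralSeries k ⊔ N := by
    intro k
    induction k with
    | zero => exact hMP.trans le_sup_left
    | succ k ih =>
      have := hnorm k
      have := hnorm (k + 1)
      rw [← h]
      refine sup_le ?_ le_sup_right
      rw [commutator_le]
      intro m hm x hx
      obtain ⟨d, hd, n, hn, rfl⟩ := mem_sup_of_normal_right.1 (ih hm)
      rw [commutatorElement_mul_left_eq_conj_mul]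
      refine mul_mem ?_ ?_
      · refine (inferInstance : (P.lowerCentralSeries (k + 1) ⊔ N).Normal).conj_mem _ ?_ d
        exact mem_sup_right (commutator_le_left N P (commutator_mem_commutator hn hx))
      · exact mem_sup_left (commutator_mem_commutator hd hx)
  have : Group.IsNilpotent P := hp.isNilpotent
  obtain ⟨k, hk⟩ := (isNilpotent_iff_lowerCentralSeries P).1 this
  have := hle k
  rw [hk, bot_sup_eq] at this
  exact absurd this hNM.not_ge

/-- `IsChiefChain a n P`: the normal subgroups `a 0, …, a n` form a chief series from `⊥` to `P`. -/
structure IsChiefChain (a : ℕ → Subgroup G) (n : ℕ) (P : Subgroup G) : Prop where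
  bot : a 0 = ⊥
  last : a n = P
  normal : ∀ i ≤ n, (a i).Normal
  lt : ∀ i < n, a i < a (i + 1)
  cov : ∀ i < n, ∀ T : Subgroup G, T.Normal → a i ≤ T → T ≤ a (i + 1) → T = a i ∨ T = a (i + 1)

/-- `A ≤ P` is invariant under the conjugation action of some supplement to `P` in `G`. -/
def IsSupplementInvariant (P A : Subgroup G) : Prop :=
  A ≤ P ∧ ∃ U : Subgroup G, U ⊔ P = ⊤ ∧ ∀ u ∈ U, ∀ x ∈ A, u * x * u⁻¹ ∈ A

open scoped Classical in
/-- The set of factors of the chain `a 0, …, a n` which are covered by `A`. -/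
noncomputable def coveredFactors (a : ℕ → Subgroup G) (n : ℕ) (A : Subgroup G) : Finset ℕ :=
  {i ∈ Finset.range n | a (i + 1) ≤ A ⊓ a (i + 1) ⊔ a i}

theorem IsChiefChain.le {a : ℕ → Subgroup G} {n : ℕ} {P : Subgroup G} (h : IsChiefChain a n P)
    {i : ℕ} (hi : i ≤ n) : a i ≤ P := by
  induction hi using Nat.decreasingInduction with
  | self => exact h.last.le
  | of_succ k hk ih => exact (h.lt k hk).le.trans ih

/-- A supplement-invariant subgroup covers or avoids each chief factor. -/
theorem IsChiefChain.covers_or_avoids [Finite G] {p : ℕ} [Fact p.Prime] {P : Subgroup G}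
    [P.Normal] (hp : IsPGroup p P) {a : ℕ → Subgroup G} {n : ℕ} (h : IsChiefChain a n P)
    {A : Subgroup G} (hA : IsSupplementInvariant P A) {i : ℕ} (hi : i < n) :
    a (i + 1) ≤ A ⊓ a (i + 1) ⊔ a i ∨ A ⊓ a (i + 1) ≤ a i := by
  obtain ⟨-, U, hUP, hU⟩ := hA
  have hM := h.normal (i + 1) hi
  have hN := h.normal i hi.le
  have hcomm := commutator_le_of_covBy_normal hp (h.le hi) (h.lt i hi) (h.cov i hi)
  have hB : A ⊓ a (i + 1) ⊔ a i ≤ a (i + 1) := sup_le inf_le_right (h.lt i hi).le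
  have hnorm : (A ⊓ a (i + 1) ⊔ a i).Normal := by
    refine normal_of_conj_mem_of_sup_eq_top hUP ?_ ?_
    · intro u hu x hx
      obtain ⟨y, hy, z, hz, rfl⟩ := mem_sup_of_normal_right.1 hx
      rw [show u * (y * z) * u⁻¹ = (u * y * u⁻¹) * (u * z * u⁻¹) by group]
      exact mul_mem_sup ⟨hU u hu y hy.1, hM.conj_mem y hy.2 u⟩ (hN.conj_mem z hz u)
    · intro v hv x hx
      have h1 := (a i).inv_mem (hcomm (commutator_mem_commutator (hB hx) hv))
      rw [commutatorElement_inv, commutatorElement_def] at h1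
      simpa using mul_mem (mem_sup_right h1) hx
  rcases h.cov i hi _ hnorm le_sup_right hB with h' | h'
  · exact Or.inr (le_sup_left.trans h'.le)
  · exact Or.inl h'.ge

theorem IsChiefChain.card_coveredFactors_lt [Finite G] {p : ℕ} [Fact p.Prime] {P : Subgroup G}
    [P.Normal] (hp : IsPGroup p P) {a : ℕ → Subgroup G} {n : ℕ} (h : IsChiefChain a n P)
    {A B : Subgroup G} (hB : IsSupplementInvariant P B)
    (hAB : A < B) : (coveredFactors a n A).card < (coveredFactors a n B).card := by
  classical
  have hsub : coveredFactors a n A ⊆ coveredFactors a n B := by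
    intro i hi
    simp only [coveredFactors, Finset.mem_filter] at hi ⊢
    exact ⟨hi.1, hi.2.trans (sup_le_sup_right (inf_le_inf_right _ hAB.le) _)⟩
  refine Finset.card_lt_card (hsub.ssubset_of_ne fun heq ↦ ?_)
  have key : ∀ i ≤ n, B ⊓ a i ≤ A := by
    intro i
    induction i with
    | zero => simp [h.bot]
    | succ i ih =>
      intro hi x hx
      have ih := ih (by omega)
      by_cases hcov : i ∈ coveredFactors a n A
      · simp only [coveredFactors, Finset.mem_filter] at hcov
        have := h.normal i (by omega)
        obtain ⟨y, hy, z, hz, rfl⟩ := mem_sup_of_normal_right.1 (hcov.2 hx.2)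
        refine mul_mem hy.1 (ih ⟨?_, hz⟩)
        exact (mul_mem_cancel_left (hAB.le hy.1)).1 hx.1
      · rw [heq] at hcov
        rcases h.covers_or_avoids hp hB (i := i) (by omega) with h1 | h1
        · exact absurd (by simpa [coveredFactors] using ⟨by omega, h1⟩) hcov
        · exact ih ⟨hx.1, h1 hx⟩
  have := key n le_rfl
  rw [h.last, inf_eq_left.2 hB.1] at this
  exact hAB.not_ge this

theorem exists_isChiefChain [Finite G] (P : Subgroup G) [hP : P.Normal] :
    ∃ a n, IsChiefChain a n P := by
  obtain ⟨a, h0, n, hn, hcov⟩ := exists_covBy_seq_of_wellFoundedLT_wellFoundedGT_of_le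
    (α := {M : Subgroup G // M.Normal}) (x := ⟨⊥, inferInstance⟩) (y := ⟨P, hP⟩) (bot_le (a := P))
  refine ⟨fun i ↦ (a i).1, n, by simp [h0], by simp [hn], fun i _ ↦ (a i).2,
    fun i hi ↦ (hcov i hi).1, fun i hi T hT h1 h2 ↦ ?_⟩
  rcases (hcov i hi).eq_or_eq (c := ⟨T, hT⟩) h1 h2 with h | h
  · exact Or.inl (congrArg Subtype.val h)
  · exact Or.inr (congrArg Subtype.val h)

theorem IsChiefChain.append {a : ℕ → Subgroup G} {n : ℕ} {N P : Subgroup G} [hP : P.Normal]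
    (h : IsChiefChain a n N) (hlt : N < P)
    (hcov : ∀ T : Subgroup G, T.Normal → N ≤ T → T ≤ P → T = N ∨ T = P) :
    IsChiefChain (fun i ↦ if i ≤ n then a i else P) (n + 1) P where
  bot := by simp [h.bot]
  last := by simp
  normal i _ := by
    split_ifs with hi
    · exact h.normal i hi
    · exact hP
  lt i hi := by
    rcases (Nat.lt_succ_iff.1 hi).lt_or_eq with hi' | rfl
    · simpa [hi'.le, Nat.succ_le_of_lt hi'] using h.lt i hi'
    · simpa [h.last] using hlt
  cov i hi := by
    rcases (Nat.lt_succ_iff.1 hi).lt_or_eq with hi' | rfl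
    · simpa [hi'.le, Nat.succ_le_of_lt hi'] using h.cov i hi'
    · simpa [h.last] using hcov

end ChiefSeries

section Supplement

variable {G X : Type*} [Group G] [Group X]

theorem index_range_eq_of_injective [Finite X] {i j : X →* G}
    (hi : Function.Injective i) (hj : Function.Injective j) : i.range.index = j.range.index := by
  have h1 := card_mul_index i.range
  have h2 := card_mul_index j.range
  rw [← Nat.card_congr (MonoidHom.ofInjective hi).toEquiv] at h1
  rw [← Nat.card_congr (MonoidHom.ofInjective hj).toEquiv] at h2
  exact Nat.eq_of_mul_eq_mul_left Nat.card_pos (h1.trans h2.symm)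

variable [Finite G]

theorem map_pCore_le_of_sup_eq_top {p : ℕ} [Fact p.Prime] {i : X →* G} [Finite X]
    (h : i.range ⊔ pCore p G = ⊤) : (pCore p X).map i ≤ pCore p G := by
  refine le_trans le_sup_left (le_pCore (N := (pCore p X).map i ⊔ pCore p G) ?_ ?_)
  · refine normal_of_conj_mem_of_sup_eq_top h ?_ ?_
    · rintro _ ⟨u, rfl⟩ x hx
      obtain ⟨_, ⟨y, hy, rfl⟩, z, hz, rfl⟩ := mem_sup_of_normal_right.1 hx
      rw [show i u * (i y * z) * (i u)⁻¹ = (i u * i y * (i u)⁻¹) * (i u * z * (i u)⁻¹) by group]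
      refine mul_mem_sup ⟨u * y * u⁻¹, ?_, by simp⟩ ?_
      · exact (inferInstance : (pCore p X).Normal).conj_mem y hy u
      · exact (inferInstance : (pCore p G).Normal).conj_mem z hz (i u)
    · intro v hv x hx
      exact mul_mem (mul_mem (mem_sup_right hv) hx) (inv_mem (mem_sup_right hv))
  · exact ((isPGroup_pCore p).map i).to_sup_of_normal_right (isPGroup_pCore p)

/-- If some `O_p(G)` is not contained in the maximal subgroup `i(X)`, then every subgroup `j(X)`
isomorphic to `i(X)` is maximal. -/
theorem isCoatom_range_of_not_pCore_le [Finite X] {i j : X →* G} (hi : Function.Injective i)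
    (hj : Function.Injective j) (hH : IsCoatom i.range) {p : ℕ} [Fact p.Prime]
    (hP : ¬ pCore p G ≤ i.range) : IsCoatom j.range := by
  set P := pCore p G with hPdef
  have hpP : IsPGroup p P := isPGroup_pCore p
  have hPc : P.Normal := inferInstance
  have hHP : i.range ⊔ P = ⊤ := hH.sup_eq_top_of_not_le hP
  have hcomap : ∀ k : X →* G, Function.Injective k → P.comap k ≤ pCore p X := fun k hk ↦
    le_pCore inferInstance (hpP.comap_of_injective k hk)
  have hOi : P.comap i = pCore p X :=
    (hcomap i hi).antisymm (map_le_iff_le_comap.1 (map_pCore_le_of_sup_eq_top hHP))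
  have hcard : ∀ k : X →* G, Function.Injective k →
      Nat.card (P.comap k) * k.range.relIndex P = Nat.card P := fun k hk ↦ by
    rw [← card_map_of_injective hk, map_comap_eq, ← inf_relIndex_right, card_mul_relIndex
      inf_le_right]
  have hindex := index_range_eq_of_injective hi hj
  have hKP : j.range ⊔ P = ⊤ := by
    have h1 := hcard i hi
    have h2 := hcard j hj
    have h3 : i.range.relIndex P = i.range.index := by
      rw [← relIndex_sup_of_normal, hHP, relIndex_top_right]
    have h4 : j.range.relIndex P * (j.range ⊔ P).index = i.range.index := by
      rw [hindex, ← relIndex_sup_of_normal, relIndex_mul_index le_sup_left]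
    have h5 : Nat.card (P.comap j) ≤ Nat.card (P.comap i) :=
      Subgroup.card_le_of_le (hOi ▸ hcomap j hj)
    rw [h3] at h1
    have hpos : 0 < Nat.card (P.comap i) := Nat.card_pos
    have hpos' : 0 < i.range.index := Nat.pos_of_ne_zero index_ne_zero_of_finite
    have h6 : i.range.index ≤ j.range.relIndex P := by
      by_contra! hlt
      have := Nat.mul_le_mul_right (j.range.relIndex P) h5
      have := Nat.mul_lt_mul_of_pos_left hlt hpos
      omega
    rw [← index_eq_one]
    have h7 : 0 < (j.range ⊔ P).index := Nat.pos_of_ne_zero index_ne_zero_of_finite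
    by_contra hne
    nlinarith [show 2 ≤ (j.range ⊔ P).index by omega]
  have hOj : (pCore p X).map j ≤ P := map_pCore_le_of_sup_eq_top hKP
  let D := i.range ⊓ P
  have hDmap : D = (pCore p X).map i := by rw [← hOi, map_comap_eq]
  have hDP : D < P := inf_le_right.lt_of_ne fun h ↦ hP (inf_eq_right.1 h)
  have hDH : ∀ u ∈ i.range, ∀ x ∈ D, u * x * u⁻¹ ∈ D := fun u hu x hx ↦
    ⟨mul_mem (mul_mem hu hx.1) (i.range.inv_mem hu), hPc.conj_mem x hx.2 u⟩
  have hDN : D.Normal := by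
    have : Group.IsNilpotent P := hpP.isNilpotent
    have h1 : D.subgroupOf P < ⊤ := by
      rw [lt_top_iff_ne_top, Ne, subgroupOf_eq_top]
      exact hDP.not_ge
    obtain ⟨⟨v, hvP⟩, hv, hvD⟩ := SetLike.exists_of_lt
      (Group.normalizerCondition_of_isNilpotent (G := P) _ h1)
    have hvD' : v ∉ i.range := fun h ↦ hvD ⟨h, hvP⟩
    have hle : i.range ≤ normalizer (D : Set G) := by
      rw [le_normalizer_iff_commutator_le_right, commutator_le]
      exact fun u hu x hx ↦ mul_mem (hDH u hu x hx) (inv_mem hx)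
    have hvn : v ∈ normalizer (D : Set G) := by
      rw [mem_normalizer_iff] at hv ⊢
      intro x
      by_cases hxP : x ∈ P
      · simpa [mem_subgroupOf] using hv ⟨x, hxP⟩
      · have : v * x * v⁻¹ ∉ P := fun h ↦ hxP (by
          simpa [mul_assoc] using hPc.conj_mem _ h v⁻¹)
        exact ⟨fun h ↦ absurd h.2 hxP, fun h ↦ absurd h.2 this⟩
    rw [← normalizer_eq_top_iff]
    exact hH.2 _ (hle.lt_of_not_ge fun h ↦ hvD' (h hvn))
  have hDcov : ∀ T : Subgroup G, T.Normal → D ≤ T → T ≤ P → T = D ∨ T = P := by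
    intro T hT hDT hTP
    by_cases hTH : T ≤ i.range
    · exact Or.inl (le_antisymm (le_inf hTH hTP) hDT)
    · refine Or.inr (le_antisymm hTP fun x hx ↦ ?_)
      have hx' : x ∈ i.range ⊔ T := by rw [hH.sup_eq_top_of_not_le hTH]; trivial
      obtain ⟨y, hy, z, hz, rfl⟩ := mem_sup_of_normal_right.1 hx'
      exact mul_mem (hDT ⟨hy, (mul_mem_cancel_right (hTP hz)).1 hx⟩) hz
  obtain ⟨a, n, ha⟩ := exists_isChiefChain D
  have hb := ha.append hDP hDcov
  set b : ℕ → Subgroup G := fun i ↦ if i ≤ n then a i else P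
  let Q : ℕ → Subgroup G := fun k ↦ ((a k).comap i).map j
  have hQinv : ∀ k ≤ n, IsSupplementInvariant P (Q k) := by
    intro k hk
    have := ha.normal k hk
    refine ⟨le_trans (map_mono ?_) hOj, j.range, hKP, ?_⟩
    · rw [← hOi]
      exact comap_mono ((ha.le hk).trans hDP.le)
    · rintro _ ⟨u, rfl⟩ _ ⟨x, hx, rfl⟩
      exact ⟨u * x * u⁻¹, (this.comap i).conj_mem x hx u, by simp⟩
  have hQlt : ∀ k < n, Q k < Q (k + 1) := by
    intro k hk
    refine (map_lt_map_iff_of_injective hj).2 (lt_of_le_not_ge (comap_mono (ha.lt k hk).le) ?_)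
    intro hle
    refine (ha.lt k hk).not_ge ?_
    have hr : a (k + 1) ≤ i.range := (ha.le hk).trans inf_le_left
    rw [← map_comap_eq_self hr]
    exact map_le_iff_le_comap.2 hle
  have hQcard : ∀ k ≤ n, k ≤ (coveredFactors b (n + 1) (Q k)).card := by
    intro k
    induction k with
    | zero => simp
    | succ k ih =>
      intro hk
      have h1 := ih (by omega)
      have h2 := hb.card_coveredFactors_lt hpP (hQinv _ hk) (hQlt k hk)
      omega
  have hQn : j.range ⊓ P ≤ Q n := by
    simp only [Q, ha.last]
    rw [← map_comap_eq]
    refine map_mono ((hcomap j hj).trans ?_)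
    rw [hDmap, comap_map_eq_self_of_injective hi]
  refine ⟨fun htop ↦ ?_, fun L hL ↦ ?_⟩
  · rw [htop, index_top, index_eq_one] at hindex
    exact hH.1 hindex
  by_contra hLtop
  have hLP : L ⊔ P = ⊤ := top_le_iff.1 (hKP ▸ sup_le_sup_right hL.le P)
  have hLinv : IsSupplementInvariant P (L ⊓ P) := ⟨inf_le_right, L, hLP, fun u hu x hx ↦
    ⟨mul_mem (mul_mem hu hx.1) (L.inv_mem hu), hPc.conj_mem x hx.2 u⟩⟩
  have hPinv : IsSupplementInvariant P P := ⟨le_rfl, L, hLP, fun u _ x hx ↦ hPc.conj_mem x hx u⟩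
  have hQnK : Q n ≤ j.range ⊓ P := le_inf (map_le_range _ _) (hQinv n le_rfl).1
  have hlt1 : Q n < L ⊓ P := by
    refine lt_of_le_not_ge (hQnK.trans (inf_le_inf_right _ hL.le)) fun hle ↦ hL.not_ge ?_
    intro l hl
    have hl' : l ∈ j.range ⊔ P := by rw [hKP]; trivial
    obtain ⟨y, hy, z, hz, rfl⟩ := mem_sup_of_normal_right.1 hl'
    exact mul_mem hy (hQnK (hle ⟨(mul_mem_cancel_left (hL.le hy)).1 hl, hz⟩)).1
  have hlt2 : L ⊓ P < P := inf_le_right.lt_of_ne fun h ↦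
    hLtop (by rw [← hLP, sup_eq_left.2 (inf_eq_right.1 h)])
  have h1 := hQcard n le_rfl
  have h2 := hb.card_coveredFactors_lt hpP hLinv hlt1
  have h3 := hb.card_coveredFactors_lt hpP hPinv hlt2
  have h4 : (coveredFactors b (n + 1) P).card ≤ n + 1 := by
    classical
    exact (Finset.card_filter_le _ _).trans (Finset.card_range _).le
  omega

end Supplement

section Reduction

open scoped commutatorElement

variable {G X : Type*} [Group G] [Group X]

theorem isCoatom_range_of_quotient {i j : X →* G} (hi : Function.Injective i)
    (hj : Function.Injective j) {N₀ : Subgroup X} {N : Subgroup G} [N.Normal]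
    (hNi : N₀.map i = N) (hNj : N₀.map j = N)
    (hquot : ∀ [N₀.Normal] (i' j' : X ⧸ N₀ →* G ⧸ N), Function.Injective i' →
      Function.Injective j' → IsCoatom i'.range → IsCoatom j'.range)
    (hH : IsCoatom i.range) : IsCoatom j.range := by
  have hci : N.comap i = N₀ := by rw [← hNi, comap_map_eq_self_of_injective hi]
  have hcj : N.comap j = N₀ := by rw [← hNj, comap_map_eq_self_of_injective hj]
  have hN₀ : N₀.Normal := hci ▸ inferInstance
  have hinj : ∀ (k : X →* G) (hk : N.comap k = N₀),
      Function.Injective (QuotientGroup.map N₀ N k hk.ge) := by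
    intro k hk
    rw [injective_iff_map_eq_one]
    intro x
    induction x using QuotientGroup.induction_on with
    | H x =>
      intro h
      rw [QuotientGroup.map_mk, QuotientGroup.eq_one_iff] at h
      rw [QuotientGroup.eq_one_iff, ← hk]
      exact h
  have hrange : ∀ (k : X →* G) (hk : N.comap k = N₀),
      (QuotientGroup.map N₀ N k hk.ge).range = k.range.map (QuotientGroup.mk' N) := by
    intro k hk
    have h : (QuotientGroup.map N₀ N k hk.ge).comp (QuotientGroup.mk' N₀) =
        (QuotientGroup.mk' N).comp k := rfl
    rw [← MonoidHom.range_comp, ← h, MonoidHom.range_comp, QuotientGroup.range_mk',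
      MonoidHom.range_eq_map]
  have hsurj := QuotientGroup.mk'_surjective N
  have h1 := hquot _ _ (hinj i hci) (hinj j hcj) (by
    rw [hrange i hci]
    refine hH.map_of_surjective hsurj ?_
    rw [QuotientGroup.ker_mk', ← hNi]
    exact map_le_range _ _)
  rw [hrange j hcj] at h1
  have h2 := isCoatom_comap_of_surjective hsurj h1
  rwa [comap_map_eq_self] at h2
  rw [QuotientGroup.ker_mk', ← hNj]
  exact map_le_range _ _

theorem eq_one_of_commute_of_isConj_inv_mul {r : ℕ} {e c : G} (he : (orderOf e).Coprime r)
    (hc : ∃ k, c ^ r ^ k = 1) (hec : Commute e c) {z : G} (hz : z * e⁻¹ * z⁻¹ = e⁻¹ * c) :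
    c = 1 := by
  obtain ⟨k, hk⟩ := hc
  have h1 : c ^ orderOf e = 1 := by
    have h2 : (z * e⁻¹ * z⁻¹) ^ orderOf e = 1 := by simp [conj_pow, pow_orderOf_eq_one]
    rwa [hz, hec.inv_left.mul_pow, inv_pow, pow_orderOf_eq_one, inv_one, one_mul] at h2
  have h3 := Nat.dvd_gcd (orderOf_dvd_of_pow_eq_one h1) (orderOf_dvd_of_pow_eq_one hk)
  rw [(he.pow_right k).gcd_eq_one] at h3
  exact orderOf_eq_one_iff.1 (Nat.dvd_one.1 h3)

variable [Finite G]

/-- If the maximal subgroup `i(X)` contains all the cores `O_s(G)` but not the centralizer of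
`O_r(G)`, then `O_r(X)` maps into `O_r(G)`. -/
theorem centralizer_pCore_le_range_of_not_map_pCore_le [Finite X] [Group.IsSolvable G] {i : X →* G}
    (hH : IsCoatom i.range) (hi : Function.Injective i)
    (hcore : ∀ s, s.Prime → pCore s G ≤ i.range) {r : ℕ} [hr : Fact r.Prime]
    (hZ : ¬ (pCore r X).map i ≤ pCore r G) :
    centralizer (pCore r G : Set G) ≤ i.range := by
  set R := pCore r G
  set Z := pCore r X
  set E := centralizer (R : Set G)
  have hE : E.Normal := inferInstance
  by_contra hEH
  have hcent : ∀ s, s.Prime → s ≠ r → Z.map i ≤ centralizer (pCore s G : Set G) := by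
    rintro s hs hsr _ ⟨z, hz, rfl⟩
    have : Fact s.Prime := ⟨hs⟩
    rw [mem_centralizer_iff]
    intro y hy
    obtain ⟨x, rfl⟩ := hcore s hs hy
    have hd := IsPGroup.disjoint_of_ne s r hsr ((pCore s G).comap i) Z
      ((isPGroup_pCore s).comap_of_injective i hi) (isPGroup_pCore r)
    rw [← map_mul, ← map_mul]
    exact congrArg i (commute_of_normal_of_disjoint _ _ inferInstance inferInstance hd x z hy hz)
  set B := normalClosure (Z.map i : Set G)
  have hZB : Z.map i ≤ B := le_normalClosure
  have hBE : B ⊓ E ≤ i.range := le_of_le_centralizer_pCore hcore fun s hs ↦ by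
    by_cases hsr : s = r
    · subst hsr
      exact inf_le_right
    · exact inf_le_left.trans (normalClosure_le_normal (hcent s hs hsr))
  have hB : B.Normal := normalClosure_normal
  have hnorm : (B ⊓ i.range).Normal := by
    refine normal_of_conj_mem_of_sup_eq_top (hH.sup_eq_top_of_not_le hEH) ?_ ?_
    · exact fun u hu x hx ↦ ⟨hB.conj_mem x hx.1 u, mul_mem (mul_mem hu hx.2) (i.range.inv_mem hu)⟩
    · intro e he x hx
      refine ⟨hB.conj_mem x hx.1 e, ?_⟩
      have h1 : ⁅e, x⁆ ∈ B ⊓ E := ⟨commutator_le_right E B (commutator_mem_commutator he hx.1),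
        commutator_le_left E B (commutator_mem_commutator he hx.1)⟩
      simpa [commutatorElement_def] using mul_mem (hBE h1) hx.2
  refine hZ (le_pCore_of_le_normal (M := B ⊓ i.range) ((isPGroup_pCore r).map i)
    (le_inf hZB (map_le_range _ _)) ?_)
  rintro _ ⟨-, u, rfl⟩ _ ⟨z, hz, rfl⟩
  exact ⟨u * z * u⁻¹, (inferInstance : Z.Normal).conj_mem z hz u, by simp⟩

theorem exists_normal_map_eq_or_centralizer_pCore_le [Finite X] [Group.IsSolvable G] {i j : X →* G}
    (hi : Function.Injective i) (hj : Function.Injective j) (hH : IsCoatom i.range)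
    (hcore : ∀ s, s.Prime → pCore s G ≤ i.range) {r : ℕ} [hr : Fact r.Prime]
    (hR : pCore r G ≠ ⊥) (hRj : pCore r G ≤ j.range) :
    (∃ N : Subgroup G, N.Normal ∧ N ≠ ⊥ ∧ ∃ N₀ : Subgroup X, N₀.map i = N ∧ N₀.map j = N) ∨
      centralizer (pCore r G : Set G) ≤ pCore r G := by
  have hcent := centralizer_pCore_le_range_of_not_map_pCore_le hH hi hcore (r := r)
  set R := pCore r G with hRdef
  set Z := pCore r X
  set E := centralizer (R : Set G)
  have hRi : R ≤ i.range := hcore r hr.1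
  have hpR : IsPGroup r R := isPGroup_pCore r
  have hZn : Z.Normal := inferInstance
  have hE : E.Normal := inferInstance
  have hRZ : ∀ k : X →* G, Function.Injective k → R ≤ k.range → R ≤ Z.map k := by
    intro k hk h
    rw [← map_comap_eq_self h]
    exact map_mono (le_pCore inferInstance (hpR.comap_of_injective k hk))
  by_cases hZ : Z.map i ≤ R
  · have h1 := le_antisymm hZ (hRZ i hi hRi)
    refine Or.inl ⟨R, inferInstance, hR, Z, h1, ?_⟩
    refine (eq_of_le_of_card_ge (hRZ j hj hRj) ?_).symm
    rw [← h1, card_map_of_injective hi, card_map_of_injective hj]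
  have hEH := hcent hZ
  have hEZR : E ⊓ Z.map i ≤ R := by
    refine le_pCore_of_le_normal (M := E) (((isPGroup_pCore r).map i).to_le inf_le_right)
      inf_le_left fun e he y hy ↦ ⟨hE.conj_mem y hy.1 e, ?_⟩
    obtain ⟨u, rfl⟩ := hEH he
    obtain ⟨-, z, hz, rfl⟩ := hy
    exact ⟨u * z * u⁻¹, hZn.conj_mem z hz u, by simp⟩
  have hcomm : ∀ e ∈ E, (orderOf e).Coprime r → ∀ z ∈ Z, Commute e (i z) := by
    intro e he hor z hz
    obtain ⟨u, rfl⟩ := hEH he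
    set c := ⁅i u, i z⁆ with hc
    have hcR : c ∈ R := by
      refine hEZR ⟨?_, ⁅u, z⁆, ?_, by simp [hc, map_commutatorElement]⟩
      · rw [hc, commutatorElement_def, mul_assoc, mul_assoc, ← mul_assoc (i z)]
        exact mul_mem he (hE.conj_mem _ (inv_mem he) _)
      · exact mul_mem (hZn.conj_mem z hz u) (inv_mem hz)
    obtain ⟨k, hk⟩ := hpR ⟨c, hcR⟩
    have hc1 : c = 1 := eq_one_of_commute_of_isConj_inv_mul (z := i z) hor
      ⟨k, by simpa using congrArg Subtype.val hk⟩ (mem_centralizer_iff.1 he c hcR).symm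
      (by rw [hc, commutatorElement_def]; group)
    exact commutatorElement_eq_one_iff_commute.1 hc1
  let S : Set G := {e | e ∈ E ∧ (orderOf e).Coprime r}
  let S₀ : Set X := {x | x ∈ centralizer (Z : Set X) ∧ (orderOf x).Coprime r}
  have hS : ∀ k : X →* G, Function.Injective k → R ≤ k.range → k '' S₀ ⊆ S := by
    rintro k hk h _ ⟨x, ⟨hx, hor⟩, rfl⟩
    refine ⟨mem_centralizer_iff.2 fun y hy ↦ ?_, by rwa [orderOf_injective k hk]⟩
    obtain ⟨z, hz, rfl⟩ := hRZ k hk h hy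
    rw [← map_mul, ← map_mul, mem_centralizer_iff.1 hx z hz]
  have hSi : i '' S₀ = S := by
    refine (hS i hi hRi).antisymm ?_
    rintro e ⟨he, hor⟩
    obtain ⟨x, rfl⟩ := hEH he
    refine ⟨x, ⟨mem_centralizer_iff.2 fun z hz ↦ hi ?_, by rwa [orderOf_injective i hi] at hor⟩, rfl⟩
    simpa using (hcomm _ he hor z hz).eq.symm
  have hTi : (closure S₀).map i = closure S := by rw [MonoidHom.map_closure, hSi]
  have hTj : (closure S₀).map j = closure S := by
    refine eq_of_le_of_card_ge ?_ ?_
    · rw [MonoidHom.map_closure]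
      exact closure_mono (hS j hj hRj)
    · rw [← hTi, card_map_of_injective hi, card_map_of_injective hj]
  by_cases hT : closure S = ⊥
  · right
    refine le_pCore hE fun ⟨e, he⟩ ↦ ?_
    obtain ⟨k, m, hm, hkm⟩ := Nat.exists_eq_pow_mul_and_not_dvd (orderOf_pos e).ne' r hr.1.ne_one
    refine ⟨k, Subtype.ext ?_⟩
    have h1 : e ^ r ^ k ∈ S := by
      refine ⟨pow_mem he _, ?_⟩
      rw [orderOf_pow_of_dvd (pow_pos hr.1.pos k).ne' ⟨m, hkm⟩, hkm,
        Nat.mul_div_cancel_left _ (pow_pos hr.1.pos k)]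
      exact ((Nat.Prime.coprime_iff_not_dvd hr.1).2 hm).symm
    have h2 := subset_closure h1
    rw [hT] at h2
    simpa using h2
  · refine Or.inl ⟨closure S, ?_, hT, closure S₀, hTi, hTj⟩
    refine ⟨fun e he g ↦ ?_⟩
    have h1 : (closure S).map (MulAut.conj g).toMonoidHom ≤ closure S := by
      rw [MonoidHom.map_closure]
      refine closure_mono ?_
      rintro _ ⟨e, ⟨he, hor⟩, rfl⟩
      refine ⟨hE.conj_mem e he g, ?_⟩
      rwa [orderOf_injective _ (MulAut.conj g).injective]
    exact h1 ⟨e, he, rfl⟩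

end Reduction

/-- The reduction to characteristic `q`, with isomorphic subgroups written as the images of two
embeddings of the same group. -/
theorem isCoatom_range_of_characteristic_prime
    (hyp : ∀ (q : ℕ), q.Prime →
      ∀ (G : Type) [Group G] [Finite G], Group.IsSolvable G →
        centralizer (pCore q G : Set G) ≤ pCore q G →
        ∀ H K : Subgroup G, IsCoatom H → Nonempty (H ≃* K) → IsCoatom K)
    {G : Type} [Group G] [Finite G] [Group.IsSolvable G] {X : Type} [Group X]
    {i j : X →* G} (hi : Function.Injective i) (hj : Function.Injective j)
    (hH : IsCoatom i.range) : IsCoatom j.range := by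
  induction hn : Nat.card G using Nat.strong_induction_on generalizing G X with
  | h n ih =>
  have : Finite X := Finite.of_injective i hi
  have happ : ∀ q, q.Prime → centralizer (pCore q G : Set G) ≤ pCore q G → IsCoatom j.range :=
    fun q hq h ↦ hyp q hq G inferInstance h _ _ hH
      ⟨(MonoidHom.ofInjective hi).symm.trans (MonoidHom.ofInjective hj)⟩
  by_cases hcore : ∀ s, s.Prime → pCore s G ≤ i.range
  swap
  · push Not at hcore
    obtain ⟨s, hs, hs'⟩ := hcore
    have : Fact s.Prime := ⟨hs⟩
    exact isCoatom_range_of_not_pCore_le hi hj hH hs'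
  obtain ⟨p, k, hp, hpk⟩ := hH.exists_index_eq_prime_pow
  by_cases hbot : ∀ r, r.Prime → r ≠ p → pCore r G = ⊥
  · refine happ p hp (le_of_le_centralizer_pCore (fun s hs ↦ ?_) fun s hs ↦ ?_) <;>
      by_cases hsp : s = p
    · rw [hsp]
    · simp [hbot s hs hsp]
    · rw [hsp]
    · rw [hbot s hs hsp, le_centralizer_iff]
      exact bot_le
  push Not at hbot
  obtain ⟨r, hr, hrp, hR⟩ := hbot
  have : Fact r.Prime := ⟨hr⟩
  have hRj : pCore r G ≤ j.range := by
    refine (isPGroup_pCore r).le_of_not_dvd_index fun h ↦ hrp ?_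
    rw [← index_range_eq_of_injective hi hj, hpk] at h
    exact (Nat.prime_dvd_prime_iff_eq hr hp).1 (hr.dvd_of_dvd_pow h)
  rcases exists_normal_map_eq_or_centralizer_pCore_le hi hj hH hcore hR hRj with
    ⟨N, hN, hN1, N₀, hNi, hNj⟩ | h
  · refine isCoatom_range_of_quotient hi hj hNi hNj (fun i' j' hi' hj' h' ↦ ?_) hH
    refine ih _ ?_ hi' hj' h' rfl
    rw [← hn, ← N.card_mul_index, ← index_eq_card]
    have h1 : 1 < Nat.card N := (one_lt_card_iff_ne_bot N).2 hN1
    have h2 : 0 < N.index := Nat.pos_of_ne_zero index_ne_zero_of_finite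
    nlinarith
  · exact happ r hr h

/-- **Theorem A.** Assume that for every prime `q` and every finite solvable group `G`
of characteristic `q` (i.e. `C_G(O_q(G)) ≤ O_q(G)`), whenever `H` and `K` are subgroups
of `G` with `H` maximal and `K ≅ H`, then `K` is maximal.  Then for every finite solvable
group `G`, whenever `H` and `K` are subgroups of `G` with `H` maximal and `K ≅ H`,
`K` is maximal in `G`. -/
theorem newman_reduction_to_characteristic_q
    (hyp : ∀ (q : ℕ), q.Prime →
      ∀ (G : Type) [Group G] [Finite G], IsSolvable G →
        Subgroup.centralizer ((pCore q G : Subgroup G) : Set G) ≤ pCore q G →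
        ∀ H K : Subgroup G, IsCoatom H → Nonempty (H ≃* K) → IsCoatom K)
    (G : Type) [Group G] [Finite G] (hG : IsSolvable G)
    (H K : Subgroup G) (hH : IsCoatom H) (hiso : Nonempty (H ≃* K)) :
    IsCoatom K := by
  obtain ⟨φ⟩ := hiso
  have : Group.IsSolvable G := hG
  have h := isCoatom_range_of_characteristic_prime hyp (i := H.subtype)
    (j := K.subtype.comp φ.toMonoidHom) H.subtype_injective
    (K.subtype_injective.comp φ.injective) (by rwa [Subgroup.range_subtype])
  rwa [MonoidHom.range_comp, MonoidHom.range_eq_top.2 φ.surjective, ← MonoidHom.range_eq_map,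
    Subgroup.range_subtype] at h
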